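/- arXiv:1912.11769 — 2 statements merged into one kernel-verified Lean document; each statement's English description precedes it below -/
import Mathlib

section
/- Fix real parameters a > 0, b ∈ (0,1), and β₂ > 0. Consider the vector field F on ℝ⁴ (coordinates (x, r₁, ε, ρ₁)) given by x' = ρ₁·r₁·ε·(a + ρ₁·r₁), r₁' = −r₁·(1 + ε)·(x + b·r₁·(1 − 2ρ₁)), ε' = ε²·(x + b·r₁·(1 − 2ρ₁)), ρ₁' = ρ₁·(x + b·r₁·(1 − 2ρ₁)). Then for every x ≤ 0 and ε ∈ [0, β₂], the point P = (x, −x/b, ε, 0) is an equilibrium of F, and the derivative of F at P has characteristic polynomial λ³·(λ − x·(1 + ε)), i.e. exactly one possibly nonzero eigenvalue x·(1 + ε), which is strictly negative whenever x < 0; in particular the surface S₁ = {(x, −x/b, ε, 0) : x ≤ 0, ε ∈ [0,β₂]} is a normally hyperbolic attracting manifold of equilibria for x < 0. -/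
/-- The desingularized system in the blow-up chart `𝔎₁` of the extended Le Corbeiller
system, coordinates `(x, r₁, ε, ρ₁)`. -/
noncomputable def corbFrakK1Field (a b : ℝ) (p : ℝ × ℝ × ℝ × ℝ) : ℝ × ℝ × ℝ × ℝ :=
  (p.2.2.2 * p.2.1 * p.2.2.1 * (a + p.2.2.2 * p.2.1),
   -p.2.1 * (1 + p.2.2.1) * (p.1 + b * p.2.1 * (1 - 2 * p.2.2.2)),
   p.2.2.1 ^ 2 * (p.1 + b * p.2.1 * (1 - 2 * p.2.2.2)),
   p.2.2.2 * (p.1 + b * p.2.1 * (1 - 2 * p.2.2.2)))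

/-- The coordinates of `ℝ × ℝ × ℝ × ℝ` as a function on `Fin 4`. -/
def prodEquivFinFour : (ℝ × ℝ × ℝ × ℝ) ≃ₗ[ℝ] (Fin 4 → ℝ) where
  toFun p := ![p.1, p.2.1, p.2.2.1, p.2.2.2]
  invFun v := (v 0, v 1, v 2, v 3)
  map_add' p q := by ext i; fin_cases i <;> rfl
  map_smul' c p := by ext i; fin_cases i <;> rfl
  left_inv _ := rfl
  right_inv v := by ext i; fin_cases i <;> rfl

@[simp] theorem prodEquivFinFour_apply (p : ℝ × ℝ × ℝ × ℝ) :
    prodEquivFinFour p = ![p.1, p.2.1, p.2.2.1, p.2.2.2] := rfl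

@[simp] theorem prodEquivFinFour_symm_apply (v : Fin 4 → ℝ) :
    prodEquivFinFour.symm v = (v 0, v 1, v 2, v 3) := rfl

/-- The derivative of `corbFrakK1Field a b` at `p`, row by row. -/
theorem fderiv_corbFrakK1Field_apply (a b : ℝ) (p v : ℝ × ℝ × ℝ × ℝ) :
    fderiv ℝ (corbFrakK1Field a b) p v =
      (let g := p.1 + b * p.2.1 * (1 - 2 * p.2.2.2)
       let dg := v.1 + b * v.2.1 * (1 - 2 * p.2.2.2) - 2 * b * p.2.1 * v.2.2.2
       ((v.2.2.2 * p.2.1 * p.2.2.1 + p.2.2.2 * v.2.1 * p.2.2.1 + p.2.2.2 * p.2.1 * v.2.2.1) *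
            (a + p.2.2.2 * p.2.1) +
          p.2.2.2 * p.2.1 * p.2.2.1 * (v.2.2.2 * p.2.1 + p.2.2.2 * v.2.1),
        -v.2.1 * (1 + p.2.2.1) * g - p.2.1 * v.2.2.1 * g - p.2.1 * (1 + p.2.2.1) * dg,
        2 * p.2.2.1 * v.2.2.1 * g + p.2.2.1 ^ 2 * dg,
        v.2.2.2 * g + p.2.2.2 * dg)) := by
  have hx : HasFDerivAt (fun q : ℝ × ℝ × ℝ × ℝ => q.1) _ p := hasFDerivAt_fst (𝕜 := ℝ)
  have hs : HasFDerivAt (fun q : ℝ × ℝ × ℝ × ℝ => q.2) _ p := hasFDerivAt_snd (𝕜 := ℝ)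
  have hr := hs.fst
  have hε := hs.snd.fst
  have hρ := hs.snd.snd
  have hg := hx.add ((hr.const_mul b).mul ((hρ.const_mul (2 : ℝ)).const_sub 1))
  have h := (((hρ.mul hr).mul hε).mul ((hρ.mul hr).const_add a)).prodMk
    (((hr.neg.mul (hε.const_add 1)).mul hg).prodMk
      (((hε.pow 2).mul hg).prodMk (hρ.mul hg)))
  have h' : HasFDerivAt (corbFrakK1Field a b) _ p := h
  rw [h'.fderiv]
  ext <;> simp <;> ring

/-- The characteristic polynomial of the linearization on the critical manifold. -/
theorem charpoly_fderiv_corbFrakK1Field (a b x ε : ℝ) (hb : b ≠ 0) :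
    LinearMap.charpoly
        ((fderiv ℝ (corbFrakK1Field a b) (x, -x / b, ε, 0)).toLinearMap) =
      Polynomial.X ^ 3 * (Polynomial.X - Polynomial.C (x * (1 + ε))) := by
  have hg : x + b * (-x / b) = 0 := by field_simp; ring
  have hM : LinearMap.toMatrix (Module.Basis.ofEquivFun prodEquivFinFour)
      (Module.Basis.ofEquivFun prodEquivFinFour)
      (fderiv ℝ (corbFrakK1Field a b) (x, -x / b, ε, 0)).toLinearMap =
      !![0, 0, 0, -x / b * ε * a;
        x / b * (1 + ε), x * (1 + ε), 0, x / b * (1 + ε) * (2 * x);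
        ε ^ 2, ε ^ 2 * b, 0, ε ^ 2 * (2 * x);
        0, 0, 0, 0] := by
    ext i j
    rw [LinearMap.toMatrix_apply, ContinuousLinearMap.coe_coe, fderiv_corbFrakK1Field_apply]
    fin_cases i <;> fin_cases j <;>
      simp [Module.Basis.coe_ofEquivFun, hg] <;> field_simp
  rw [← LinearMap.charpoly_toMatrix _ (Module.Basis.ofEquivFun prodEquivFinFour), hM]
  simp [Matrix.charpoly, Matrix.charmatrix, Matrix.det_succ_row_zero, Fin.sum_univ_succ,
    Fin.succAbove]
  ring

/-- The critical manifold `S₁ = {(x, −x/b, ε, 0)}` consists of equilibria whose linearization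
has characteristic polynomial `λ³(λ − x(1+ε))`, with the single possibly nonzero eigenvalue
`x(1+ε)` strictly negative for `x < 0`. -/
theorem corbFrakK1_critical_manifold_S (a b β₂ : ℝ) (ha : 0 < a)
    (hb : b ∈ Set.Ioo (0 : ℝ) 1) (hβ₂ : 0 < β₂)
    (x ε : ℝ) (hx : x ≤ 0) (hε : ε ∈ Set.Icc (0 : ℝ) β₂) :
    corbFrakK1Field a b (x, -x / b, ε, 0) = 0 ∧
    LinearMap.charpoly
        ((fderiv ℝ (corbFrakK1Field a b) (x, -x / b, ε, 0)).toLinearMap) =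
      Polynomial.X ^ 3 * (Polynomial.X - Polynomial.C (x * (1 + ε))) ∧
    (x < 0 → x * (1 + ε) < 0) := by
  have hb0 : b ≠ 0 := hb.1.ne'
  refine ⟨?_, charpoly_fderiv_corbFrakK1Field a b x ε hb0, fun h => ?_⟩
  · have hg : x + b * (-x / b) = 0 := by field_simp; ring
    simp [corbFrakK1Field, hg]
  · exact mul_neg_of_neg_of_pos h (by linarith [hε.1])
end

section
/- Fix real parameters a > 0 and b ∈ (0,1), and let E : ℝ → ℝ be given by E(s) = exp(−1/s) for s > 0 and E(s) = 0 for s ≤ 0. Consider the vector field F on ℝ³ (coordinates (r₁₁, ε₁, s₁)) given by r₁₁' = r₁₁·(1 + b·s₁·r₁₁·(2 − E(ε₁)) − 2r₁₁·(a − r₁₁·s₁²)), ε₁' = −ε₁·(1 + b·s₁·r₁₁·(2 − E(ε₁))), s₁' = s₁·r₁₁·(a − r₁₁·s₁²). Then: (i) the origin q_s = (0,0,0) is an equilibrium of F whose derivative there has eigenvalues 1, −1, 0; (ii) the point (1/(2a), 0, 0) is an equilibrium of F; (iii) the lines 𝒢 = {(1/(2a), ε₁, 0) : ε₁ ≥ 0}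 and ℋ = {(0, ε₁, 0) : ε₁ ≥ 0} are invariant, and on each of them the dynamics are ε₁' = −ε₁, so ε₁ is strictly decreasing along both lines away from ε₁ = 0. -/
/-- The exponential `exp(−1/s)` extended by `0` to `s ≤ 0`. -/
noncomputable def expE (s : ℝ) : ℝ := if 0 < s then Real.exp (-1 / s) else 0

/-- The desingularized system in chart `K₁₁` of the weighted cylindrical blow-up of the
non-hyperbolic circle `L` in the algebraic regime of the Le Corbeiller analysis;
coordinates `(r₁₁, ε₁, s₁)`. -/
noncomputable def corbK11Field (a b : ℝ) (p : ℝ × ℝ × ℝ) : ℝ × ℝ × ℝ :=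
  (p.1 * (1 + b * p.2.2 * p.1 * (2 - expE p.2.1) - 2 * p.1 * (a - p.1 * p.2.2 ^ 2)),
   -p.2.1 * (1 + b * p.2.2 * p.1 * (2 - expE p.2.1)),
   p.2.2 * p.1 * (a - p.1 * p.2.2 ^ 2))

open Polynomial in
theorem LinearMap.charpoly_smul_id_self {R : Type*} [CommRing R] [Nontrivial R] (c : R) :
    (c • LinearMap.id : R →ₗ[R] R).charpoly = X - C c := by
  rw [← LinearMap.charpoly_toMatrix _ (Module.Basis.singleton Unit R)]
  simp [Matrix.charpoly, Matrix.charmatrix, Module.Basis.toMatrix_apply]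

theorem expE_eq_expNegInvGlue : expE = expNegInvGlue := by
  funext s
  rcases lt_or_ge 0 s with h | h
  · simp [expE, expNegInvGlue, h, h.not_ge, neg_div]
  · simp [expE, expNegInvGlue, h, h.not_gt]

theorem differentiable_expE : Differentiable ℝ expE := by
  rw [expE_eq_expNegInvGlue]
  exact (expNegInvGlue.contDiff (n := 1)).differentiable (by norm_num)

/-- The linearization at the origin is `diag(1, −1, 0)`. -/
theorem fderiv_corbK11Field_zero (a b : ℝ) :
    (fderiv ℝ (corbK11Field a b) (0, 0, 0)).toLinearMap =
      ((1 : ℝ) • LinearMap.id).prodMap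
        (((-1 : ℝ) • LinearMap.id).prodMap ((0 : ℝ) • LinearMap.id)) := by
  have hr : HasFDerivAt (fun p : ℝ × ℝ × ℝ => p.1) _ (0, 0, 0) := hasFDerivAt_fst (𝕜 := ℝ)
  have hε : HasFDerivAt (fun p : ℝ × ℝ × ℝ => p.2.1) _ (0, 0, 0) :=
    (hasFDerivAt_snd (𝕜 := ℝ) (p := ((0, 0, 0) : ℝ × ℝ × ℝ))).fst
  have hs : HasFDerivAt (fun p : ℝ × ℝ × ℝ => p.2.2) _ (0, 0, 0) :=
    (hasFDerivAt_snd (𝕜 := ℝ) (p := ((0, 0, 0) : ℝ × ℝ × ℝ))).snd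
  have hE : HasFDerivAt (fun p : ℝ × ℝ × ℝ => expE p.2.1) _ (0, 0, 0) :=
    HasFDerivAt.comp (g := expE) ((0, 0, 0) : ℝ × ℝ × ℝ) (differentiable_expE 0).hasFDerivAt hε
  have hu := (((hs.const_mul b).mul hr).mul (hE.const_sub 2)).const_add 1
  have hv := (hr.mul (hs.pow 2)).const_sub a
  have h := (hr.mul (hu.sub ((hr.const_mul 2).mul hv))).prodMk
    ((hε.neg.mul hu).prodMk ((hs.mul hr).mul hv))
  have hF : HasFDerivAt (corbK11Field a b) _ (0, 0, 0) := h
  rw [hF.fderiv]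
  ext <;> simp

/-- The origin `q_s` is an equilibrium with eigenvalues `1, −1, 0` (characteristic
polynomial `λ(λ − 1)(λ + 1)`); the point `(1/(2a), 0, 0)` is an equilibrium; and the lines
`𝒢 = {(1/(2a), ε₁, 0)}` and `ℋ = {(0, ε₁, 0)}` are invariant, with dynamics `ε₁' = −ε₁` on
both, so `ε₁` is strictly decreasing along both lines away from `ε₁ = 0`. -/
theorem corbK11_structure (a b : ℝ) (ha : 0 < a) (hb : b ∈ Set.Ioo (0 : ℝ) 1) :
    corbK11Field a b (0, 0, 0) = 0 ∧
    LinearMap.charpoly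
        ((fderiv ℝ (corbK11Field a b) (0, 0, 0)).toLinearMap) =
      Polynomial.X * (Polynomial.X - 1) * (Polynomial.X + 1) ∧
    corbK11Field a b (1 / (2 * a), 0, 0) = 0 ∧
    (∀ ε₁ : ℝ, 0 ≤ ε₁ → corbK11Field a b (1 / (2 * a), ε₁, 0) = (0, -ε₁, 0)) ∧
    (∀ ε₁ : ℝ, 0 ≤ ε₁ → corbK11Field a b (0, ε₁, 0) = (0, -ε₁, 0)) ∧
    (∀ ε₁ : ℝ, 0 < ε₁ → -ε₁ < 0) := by
  refine ⟨by simp [corbK11Field], ?_, ?_, fun ε₁ _ => ?_, fun ε₁ _ => by simp [corbK11Field],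
    fun ε₁ h => neg_neg_of_pos h⟩
  · rw [fderiv_corbK11Field_zero, LinearMap.charpoly_prodMap, LinearMap.charpoly_prodMap]
    simp only [LinearMap.charpoly_smul_id_self, map_neg, map_one, map_zero]
    ring
  · simp [corbK11Field]
    field_simp
    simp
  · simp [corbK11Field]
    field_simp
    simp
end
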